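/- Let A be a commutative ring and let F be a cochain complex of A-modules which is both acyclic and K-flat. Then for every cochain complex G of A-modules, the tensor product complex G ⊗_A F is acyclic. -/

import Mathlib

/-!
STATEMENT 8: Let `A` be a commutative ring and `F` a cochain complex of `A`-modules
which is both acyclic and K-flat (i.e. `G ⊗_A F` is acyclic for every acyclic `G`).
Then for *every* cochain complex `G` of `A`-modules, `G ⊗_A F` is acyclic.

Here the tensor product of complexes is `HomologicalComplex.tensorObj`, whose degree `n`
part is `⊕_{i+j=n} G^i ⊗_A F^j`, with the usual Koszul sign differential.
-/

open CategoryTheory Limits MonoidalCategory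

variable {A : Type} [CommRing A]

instance : (curriedTensor (ModuleCat A)).Additive where
  map_add := by intros; ext; simp [curriedTensor]

instance (X : ModuleCat A) : ((curriedTensor (ModuleCat A)).obj X).Additive :=
  inferInstanceAs (tensorLeft X).Additive

/-- A cochain complex is acyclic if it is exact in every degree. -/
def IsAcyclic (C : CochainComplex (ModuleCat A) ℤ) : Prop := ∀ i : ℤ, C.ExactAt i

/-- A cochain complex `F` of `A`-modules is K-flat if `G ⊗_A F` is acyclic
for every acyclic cochain complex `G`. -/
def IsKFlat (F : CochainComplex (ModuleCat A) ℤ) : Prop :=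
  ∀ G : CochainComplex (ModuleCat A) ℤ, IsAcyclic G →
    IsAcyclic (HomologicalComplex.tensorObj G F)


namespace KFlatAux

open HomologicalComplex

noncomputable section

variable (G F : CochainComplex (ModuleCat.{0} A) ℤ)

/-- the tensor product complex -/
abbrev Tot : CochainComplex (ModuleCat.{0} A) ℤ := HomologicalComplex.tensorObj G F

/-- inclusion of a summand -/
def inc (i j n : ℤ) (h : i + j = n) : G.X i ⊗ F.X j ⟶ (Tot G F).X n :=
  ιTensorObj G F i j n h

/-- projection on a summand -/
def pr (i j n : ℤ) (h : i + j = n) : (Tot G F).X n ⟶ G.X i ⊗ F.X j :=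
  mapBifunctorDesc (fun i' j' h' =>
    if e : i' = i then
      eqToHom (by
        have h'' : i' + j' = n := h'
        obtain rfl : i' = i := e
        obtain rfl : j' = j := by omega
        rfl)
    else 0)

lemma inc_pr_self (i j n : ℤ) (h : i + j = n) :
    inc G F i j n h ≫ pr G F i j n h = 𝟙 _ := by
  unfold inc pr
  erw [ι_mapBifunctorDesc]
  simp

lemma inc_pr_ne (i j n : ℤ) (h : i + j = n) (i' j' : ℤ) (h' : i' + j' = n) (hne : i ≠ i') :
    inc G F i j n h ≫ pr G F i' j' n h' = 0 := by
  unfold inc pr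
  erw [ι_mapBifunctorDesc]
  simp [hne]

lemma inc_d (i j n m i' j' : ℤ) (h : i + j = n) (hm : n + 1 = m) (hi : i + 1 = i')
    (hj : j + 1 = j') :
    inc G F i j n h ≫ (Tot G F).d n m =
      (G.d i i' ▷ F.X j) ≫ inc G F i' j m (by omega) +
      i.negOnePow • ((G.X i ◁ F.d j j') ≫ inc G F i j' m (by omega)) := by
  unfold inc
  rw [mapBifunctor.d_eq, Preadditive.comp_add]
  erw [mapBifunctor.ι_D₁, mapBifunctor.ι_D₂]
  rw [mapBifunctor.d₁_eq _ _ _ _ (show (ComplexShape.up ℤ).Rel i i' from hi) j m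
      (show i' + j = m by omega),
    mapBifunctor.d₂_eq _ _ _ _ i (show (ComplexShape.up ℤ).Rel j j' from hj) m
      (show i + j' = m by omega)]
  have e1 : ComplexShape.ε₁ (ComplexShape.up ℤ) (ComplexShape.up ℤ) (ComplexShape.up ℤ) (i, j)
    = 1 := rfl
  have e2 : ComplexShape.ε₂ (ComplexShape.up ℤ) (ComplexShape.up ℤ) (ComplexShape.up ℤ) (i, j)
    = i.negOnePow := rfl
  rw [e1, e2, one_smul]
  rfl

lemma hom_ext' {n : ℤ} {Y : ModuleCat.{0} A} (f g : (Tot G F).X n ⟶ Y)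
    (h : ∀ i j h, inc G F i j n h ≫ f = inc G F i j n h ≫ g) : f = g :=
  mapBifunctor.hom_ext h

lemma d_pr (n m i j i' j' : ℤ) (hm : n + 1 = m) (hi : i' + 1 = i) (hj : j' + 1 = j)
    (h : i + j = m) :
    (Tot G F).d n m ≫ pr G F i j m h =
      pr G F i' j n (by omega) ≫ (G.d i' i ▷ F.X j) +
      i.negOnePow • (pr G F i j' n (by omega) ≫ (G.X i ◁ F.d j' j)) := by
  apply hom_ext'
  intro a b hab
  rw [← Category.assoc, inc_d G F a b n m (a+1) (b+1) hab hm rfl rfl]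
  simp only [Preadditive.comp_add, Preadditive.add_comp, Linear.units_smul_comp,
    Linear.comp_units_smul, Category.assoc]
  by_cases h1 : a = i'
  · subst h1
    obtain rfl : a + 1 = i := hi
    obtain rfl : b = j := by omega
    rw [inc_pr_self, inc_pr_ne _ _ _ _ _ _ _ _ _ (by omega), ← Category.assoc, inc_pr_self,
      ← Category.assoc (inc G F _ _ _ _) (pr G F _ _ _ _), inc_pr_ne _ _ _ _ _ _ _ _ _ (by omega)]
    simp
  · by_cases h2 : a = i
    · subst h2
      obtain rfl : b = j' := by omega
      obtain rfl : b + 1 = j := hj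
      rw [inc_pr_self, inc_pr_ne _ _ _ _ _ _ _ _ _ (by omega), ← Category.assoc,
        inc_pr_ne _ _ _ _ _ _ _ _ _ (by omega),
        ← Category.assoc (inc G F _ _ _ _) (pr G F _ _ _ _), inc_pr_self]
      simp
    · rw [inc_pr_ne _ _ _ _ _ _ _ _ _ (by omega), inc_pr_ne _ _ _ _ _ _ _ _ _ (by omega),
        ← Category.assoc, inc_pr_ne _ _ _ _ _ _ _ _ _ (by omega),
        ← Category.assoc (inc G F _ _ _ _) (pr G F _ _ _ _), inc_pr_ne _ _ _ _ _ _ _ _ _ (by omega)]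
      simp

variable {G F}

lemma pr_d_apply (n m i j i' j' : ℤ) (hm : n + 1 = m) (hi : i' + 1 = i) (hj : j' + 1 = j)
    (h : i + j = m) (x : (Tot G F).X n) :
    pr G F i j m h ((Tot G F).d n m x) =
      (G.d i' i ▷ F.X j) (pr G F i' j n (by omega) x) +
      ((i.negOnePow : ℤˣ) : ℤ) • ((G.X i ◁ F.d j' j) (pr G F i j' n (by omega) x)) := by
  have := congrArg (fun f => f x) (congrArg (fun f => f.hom) (d_pr G F n m i j i' j' hm hi hj h))
  simp only [ModuleCat.hom_comp, ModuleCat.hom_add, LinearMap.add_apply, LinearMap.comp_apply] at this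
  exact this

lemma pr_inc_self (i j n : ℤ) (h : i + j = n) (x : (G.X i ⊗ F.X j : ModuleCat.{0} A)) :
    pr G F i j n h (inc G F i j n h x) = x := by
  have := congrArg (fun f => f x) (congrArg (fun f => f.hom) (inc_pr_self G F i j n h))
  simpa using this

lemma pr_inc_ne (i j n : ℤ) (h : i + j = n) (i' j' : ℤ) (h' : i' + j' = n) (hne : i ≠ i')
    (x : (G.X i ⊗ F.X j : ModuleCat.{0} A)) :
    pr G F i' j' n h' (inc G F i j n h x) = 0 := by
  have := congrArg (fun f => f x) (congrArg (fun f => f.hom) (inc_pr_ne G F i j n h i' j' h' hne))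
  simpa using this

lemma tot_induction {n : ℤ} (P : (Tot G F).X n → Prop) (h0 : P 0)
    (hadd : ∀ x y, P x → P y → P (x + y))
    (hinc : ∀ i j h x, P (inc G F i j n h x)) (x : (Tot G F).X n) : P x := by
  let S : Submodule A ((Tot G F).X n) :=
    ⨆ q : { q : ℤ × ℤ // q.1 + q.2 = n }, LinearMap.range (inc G F q.1.1 q.1.2 n q.2).hom
  have hS : ModuleCat.ofHom S.mkQ = 0 := by
    apply hom_ext'
    intro i j h
    rw [comp_zero]
    ext1
    apply LinearMap.ext
    intro y
    have : inc G F i j n h y ∈ S :=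
      Submodule.mem_iSup_of_mem (p := fun q : { q : ℤ × ℤ // q.1 + q.2 = n } =>
        LinearMap.range (inc G F q.1.1 q.1.2 n q.2).hom) ⟨(i, j), h⟩ ⟨y, rfl⟩
    exact (Submodule.Quotient.mk_eq_zero S).2 this
  have hx : x ∈ S := by
    have := congrArg (fun f => f x) (congrArg (fun f => f.hom) hS)
    exact (Submodule.Quotient.mk_eq_zero S).1 this
  refine Submodule.iSup_induction _ (motive := P) hx ?_ h0 hadd
  rintro ⟨q, hq⟩ _ ⟨y, rfl⟩
  exact hinc _ _ _ y

lemma exists_sum {n : ℤ} (x : (Tot G F).X n) : ∃ S : Finset ℤ, ∀ T : Finset ℤ, S ⊆ T →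
    x = ∑ i ∈ T, inc G F i (n - i) n (by omega) (pr G F i (n - i) n (by omega) x) := by
  classical
  refine tot_induction (fun x => ∃ S : Finset ℤ, ∀ T : Finset ℤ, S ⊆ T →
    x = ∑ i ∈ T, inc G F i (n - i) n (by omega) (pr G F i (n - i) n (by omega) x)) ?_ ?_ ?_ x
  · exact ⟨∅, fun T _ => by simp⟩
  · rintro x y ⟨S, hS⟩ ⟨S', hS'⟩
    refine ⟨S ∪ S', fun T hT => ?_⟩
    simp only [map_add, Finset.sum_add_distrib]
    rw [← hS T (Finset.union_subset_left hT), ← hS' T (Finset.union_subset_right hT)]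
  · intro i j h x
    refine ⟨{i}, fun T hT => ?_⟩
    obtain rfl : j = n - i := by omega
    rw [Finset.sum_eq_single i, pr_inc_self]
    · intro k _ hk
      rw [pr_inc_ne _ _ _ _ _ _ _ hk.symm, map_zero]
    · intro hi
      exact absurd (hT (Finset.mem_singleton_self i)) hi

lemma tot_ext {n : ℤ} (x y : (Tot G F).X n)
    (h : ∀ i j h, pr G F i j n h x = pr G F i j n h y) : x = y := by
  classical
  obtain ⟨S, hS⟩ := exists_sum x
  obtain ⟨S', hS'⟩ := exists_sum y
  rw [hS (S ∪ S') Finset.subset_union_left, hS' (S ∪ S') Finset.subset_union_right]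
  simp only [h]

lemma exists_bound {n : ℤ} (x : (Tot G F).X n) :
    ∃ N : ℕ, ∀ (i j : ℤ) h, (i < -(N : ℤ) ∨ (N : ℤ) < i) → pr G F i j n h x = 0 := by
  obtain ⟨S, hS⟩ := exists_sum x
  refine ⟨∑ i ∈ S, i.natAbs, fun i j h hi => ?_⟩
  have hiS : i ∉ S := by
    intro hmem
    have : i.natAbs ≤ ∑ i ∈ S, i.natAbs :=
      Finset.single_le_sum (f := fun i : ℤ => i.natAbs) (fun _ _ => Nat.zero_le _) hmem
    omega
  rw [hS S subset_rfl, map_sum]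
  refine Finset.sum_eq_zero fun k hk => pr_inc_ne _ _ _ _ _ _ _ ?_ _
  rintro rfl
  exact hiS hk


/-- `M ⊗ F` is exact -/
def TE (F : CochainComplex (ModuleCat.{0} A) ℤ) (M : ModuleCat.{0} A) : Prop :=
  ∀ i j k : ℤ, i + 1 = j → j + 1 = k → ∀ x : (M ⊗ F.X j : ModuleCat.{0} A),
    (M ◁ F.d j k) x = 0 → ∃ y : (M ⊗ F.X i : ModuleCat.{0} A), (M ◁ F.d i j) y = x

lemma exactAt_iff_elem (K : CochainComplex (ModuleCat.{0} A) ℤ) (i j k : ℤ) (hi : i + 1 = j)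
    (hk : j + 1 = k) :
    K.ExactAt j ↔ ∀ x : K.X j, K.d j k x = 0 → ∃ y : K.X i, K.d i j y = x := by
  rw [K.exactAt_iff' i j k (by rw [CochainComplex.prev]; omega) (by rw [CochainComplex.next]; omega),
    ShortComplex.moduleCat_exact_iff]
  rfl

lemma d_d_apply (K : CochainComplex (ModuleCat.{0} A) ℤ) (i j k : ℤ) (x : K.X i) :
    K.d j k (K.d i j x) = 0 := by
  have := congrArg (fun f => f x) (congrArg (fun f => f.hom) (K.d_comp_d i j k))
  exact this

lemma whisker_exch {M N : ModuleCat.{0} A} {X Y : ModuleCat.{0} A} (f : M ⟶ N) (g : X ⟶ Y)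
    (x : (M ⊗ X : ModuleCat.{0} A)) : (N ◁ g) ((f ▷ X) x) = (f ▷ Y) ((M ◁ g) x) := by
  have := congrArg (fun f => f x) (congrArg (fun f => f.hom) (whisker_exchange f g))
  exact this.symm

lemma whisker_comp {L M N : ModuleCat.{0} A} (f : L ⟶ M) (g : M ⟶ N) (X : ModuleCat.{0} A)
    (x : (L ⊗ X : ModuleCat.{0} A)) : (g ▷ X) ((f ▷ X) x) = ((f ≫ g) ▷ X) x := by
  rw [comp_whiskerRight]
  rfl

lemma whisker_comp_zero {L M N : ModuleCat.{0} A} (f : L ⟶ M) (g : M ⟶ N) (h : f ≫ g = 0)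
    (X : ModuleCat.{0} A)
    (x : (L ⊗ X : ModuleCat.{0} A)) : (g ▷ X) ((f ▷ X) x) = 0 := by
  rw [whisker_comp, h, MonoidalPreadditive.zero_whiskerRight]
  rfl

lemma negOnePow_smul_smul {M : Type} [AddCommGroup M] (i : ℤ) (x : M) :
    ((i.negOnePow : ℤˣ) : ℤ) • ((i.negOnePow : ℤˣ) : ℤ) • x = x := by
  rw [smul_smul, ← Units.val_mul, Int.units_mul_self]
  simp

lemma negOnePow_smul_eq_zero {M : Type} [AddCommGroup M] (i : ℤ) (x : M)
    (h : ((i.negOnePow : ℤˣ) : ℤ) • x = 0) : x = 0 := by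
  rw [← negOnePow_smul_smul i x, h, smul_zero]

lemma pr_d_inc_lt (i j n m : ℤ) (h : i + j = n) (hm : n + 1 = m)
    (x : (G.X i ⊗ F.X j : ModuleCat.{0} A)) (a b : ℤ) (hab : a + b = m) (ha : a < i) :
    pr G F a b m hab ((Tot G F).d n m (inc G F i j n h x)) = 0 := by
  rw [pr_d_apply n m a b (a - 1) (b - 1) hm (by omega) (by omega),
    pr_inc_ne _ _ _ _ _ _ _ (by omega), pr_inc_ne _ _ _ _ _ _ _ (by omega)]
  simp

lemma pr_d_inc_self (i j n m j' : ℤ) (h : i + j = n) (hm : n + 1 = m) (hj : j + 1 = j')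
    (x : (G.X i ⊗ F.X j : ModuleCat.{0} A)) :
    pr G F i j' m (by omega) ((Tot G F).d n m (inc G F i j n h x)) =
      ((i.negOnePow : ℤˣ) : ℤ) • ((G.X i ◁ F.d j j') x) := by
  rw [pr_d_apply n m i j' (i - 1) j hm (by omega) (by omega),
    pr_inc_ne _ _ _ _ _ _ _ (by omega), pr_inc_self]
  simp

lemma clear_le (b : ℤ) (hTE : ∀ i ≤ b, TE F (G.X i)) (p n m : ℤ) (hp : p + 1 = n) (hm : n + 1 = m)
    (y : (Tot G F).X n)
    (hy : ∀ i j h, i ≤ b → pr G F i j m h ((Tot G F).d n m y) = 0) :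
    ∃ u : (Tot G F).X p, (∀ i j h, b < i → pr G F i j p h u = 0) ∧
      ∀ i j h, i ≤ b → pr G F i j n h (y - (Tot G F).d p n u) = 0 := by
  obtain ⟨N, hN⟩ := exists_bound y
  have key : ∀ k : ℕ, ∃ u : (Tot G F).X p, (∀ i j h, b < i → pr G F i j p h u = 0) ∧
      ∀ i j h, i ≤ b → i < -(N : ℤ) + k → pr G F i j n h (y - (Tot G F).d p n u) = 0 := by
    intro k
    induction k with
    | zero =>
      refine ⟨0, fun i j h _ => by simp, fun i j h _ hi => ?_⟩
      simpa using hN i j h (Or.inl (by simpa using hi))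
    | succ k ih =>
      obtain ⟨u, hu, hu'⟩ := ih
      by_cases hk : b < -(N : ℤ) + k
      · exact ⟨u, hu, fun i j h hi _ => hu' i j h hi (by omega)⟩
      push Not at hk
      obtain ⟨a, ha⟩ : ∃ a : ℤ, a = -(N : ℤ) + k := ⟨_, rfl⟩
      rw [← ha] at hk hu'
      obtain ⟨y', hy'⟩ : ∃ y', y' = y - (Tot G F).d p n u := ⟨_, rfl⟩
      have hdy' : (Tot G F).d n m y' = (Tot G F).d n m y := by
        rw [hy', map_sub, d_d_apply, sub_zero]
      have h1 := pr_d_apply n m a (m - a) (a - 1) (m - a - 1) hm (by omega) (by omega)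
        (by omega) y'
      rw [hdy', hy _ _ _ hk, hy', hu' (a - 1) _ _ (by omega) (by omega), map_zero, zero_add] at h1
      have h2 := negOnePow_smul_eq_zero _ _ h1.symm
      obtain ⟨w, hw⟩ := hTE a hk (m - a - 2) (m - a - 1) (m - a) (by omega) (by omega) _ h2
      refine ⟨u + inc G F a (m - a - 2) p (by omega) (((a.negOnePow : ℤˣ) : ℤ) • w), ?_, ?_⟩
      · intro i j h hi
        rw [map_add, hu i j h hi, pr_inc_ne _ _ _ _ _ _ _ (by omega), add_zero]
      · intro i j h hi hi'
        rw [map_add, ← sub_sub, map_sub]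
        by_cases hia : i = a
        · subst hia
          obtain rfl : j = m - i - 1 := by omega
          rw [pr_d_inc_self _ _ _ _ _ _ hp (by omega), map_zsmul, negOnePow_smul_smul, hw, sub_self]
        · rw [pr_d_inc_lt _ _ _ _ _ hp _ _ _ _ (by push_cast at hi'; omega),
            hu' i j h hi (by push_cast at hi'; omega), sub_zero]
  obtain ⟨u, hu, hu'⟩ := key (b + N + 1).toNat
  refine ⟨u, hu, fun i j h hi => hu' i j h hi ?_⟩
  omega

theorem tensor_of_TE (F : CochainComplex (ModuleCat.{0} A) ℤ) (hF : ∀ M, TE F M)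
    (G : CochainComplex (ModuleCat.{0} A) ℤ) : IsAcyclic (Tot G F) := by
  intro n
  rw [exactAt_iff_elem _ (n - 1) n (n + 1) (by omega) rfl]
  intro z hz
  obtain ⟨N, hN⟩ := exists_bound z
  obtain ⟨b, hb⟩ : ∃ b : ℤ, b = N := ⟨_, rfl⟩
  rw [← hb] at hN
  obtain ⟨u, hu, hu'⟩ := clear_le (G := G) (b + 1) (fun i _ => hF _) (n - 1) n (n + 1) (by omega) rfl z
    (fun i j h _ => by rw [hz, map_zero])
  obtain ⟨w, hw⟩ : ∃ w, w = pr G F (b + 1) (n - 1 - (b + 1)) (n - 1) (by omega) u := ⟨_, rfl⟩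
  -- the differential, restricted to the kernel
  let f := G.d (b + 2) (b + 3)
  let Z : ModuleCat.{0} A := ModuleCat.of A (LinearMap.ker f.hom)
  let s : Z ⟶ G.X (b + 2) := ModuleCat.ofHom (LinearMap.ker f.hom).subtype
  let t : G.X (b + 1) ⟶ Z := ModuleCat.ofHom (LinearMap.codRestrict (LinearMap.ker f.hom)
    (G.d (b + 1) (b + 2)).hom (fun x => d_d_apply G _ _ _ x))
  have hts : t ≫ s = G.d (b + 1) (b + 2) := rfl
  have hsf : s ≫ f = 0 := by
    ext x
    exact x.2
  have hdt : G.d b (b + 1) ≫ t = 0 := by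
    ext x
    exact d_d_apply G b (b + 1) (b + 2) x
  -- the component `b + 1`
  have h1 := hu' (b + 1) (n - (b + 1)) (by omega) le_rfl
  rw [map_sub, hN _ _ _ (Or.inr (by omega)), pr_d_apply (n - 1) n (b + 1) (n - (b + 1)) b
    (n - 1 - (b + 1)) (by omega) rfl (by omega), ← hw, zero_sub, neg_eq_zero] at h1
  have h2 : (G.X (b + 1) ◁ F.d (n - 1 - (b + 1)) (n - (b + 1))) w =
      (G.d b (b + 1) ▷ F.X (n - (b + 1))) (-(((b + 1).negOnePow : ℤˣ) : ℤ) •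
        pr G F b (n - (b + 1)) (n - 1) (by omega) u) := by
    rw [map_zsmul, neg_smul, eq_neg_of_add_eq_zero_left h1, smul_neg, neg_neg, negOnePow_smul_smul]
  have h3 : (Z ◁ F.d (n - 1 - (b + 1)) (n - (b + 1))) ((t ▷ F.X _) w) = 0 := by
    rw [whisker_exch, h2]
    exact whisker_comp_zero _ _ hdt _ _
  obtain ⟨v, hv⟩ := hF Z (n - 1 - (b + 2)) (n - 1 - (b + 1)) (n - (b + 1)) (by omega) (by omega) _ h3
  have h4 : (G.X (b + 2) ◁ F.d (n - 1 - (b + 2)) (n - 1 - (b + 1))) ((s ▷ F.X _) v) =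
      (G.d (b + 1) (b + 2) ▷ F.X _) w := by
    rw [whisker_exch, hv, whisker_comp, hts]
  obtain ⟨q, hq⟩ : ∃ q, q = inc G F (b + 2) (n - 1 - (b + 2)) (n - 1) (by omega)
    ((((b + 2).negOnePow : ℤˣ) : ℤ) • (s ▷ F.X _) v) := ⟨_, rfl⟩
  refine ⟨u - q, ?_⟩
  have h5 : (Tot G F).d (n - 1) n q = -(z - (Tot G F).d (n - 1) n u) := by
    apply tot_ext
    intro i j h
    rw [map_neg]
    rcases lt_trichotomy i (b + 2) with hi | rfl | hi
    · rw [hu' _ _ _ (by omega), hq, pr_d_inc_lt _ _ _ _ _ (by omega) _ _ _ _ hi, neg_zero]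
    · obtain rfl : j = n - 1 - (b + 1) := by omega
      rw [hq, pr_d_inc_self _ _ _ _ _ _ (by omega) (by omega), map_zsmul, negOnePow_smul_smul, h4,
        map_sub, hN _ _ _ (Or.inr (by omega)), zero_sub, neg_neg,
        pr_d_apply (n - 1) n (b + 2) (n - 1 - (b + 1)) (b + 1) (n - 1 - (b + 2)) (by omega)
          (by omega) (by omega), hu (b + 2) _ _ (by omega), map_zero, smul_zero, add_zero, hw]
    · rw [map_sub, hN _ _ _ (Or.inr (by omega)), zero_sub, neg_neg,
        pr_d_apply (n - 1) n i j (i - 1) (j - 1) (by omega) (by omega) (by omega) _ u,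
        hu (i - 1) _ _ (by omega), hu i _ _ (by omega), map_zero, map_zero, smul_zero, add_zero, hq]
      by_cases hi3 : i = b + 3
      · subst hi3
        obtain rfl : j = n - 1 - (b + 2) := by omega
        rw [pr_d_apply (n - 1) n (b + 3) (n - 1 - (b + 2)) (b + 2) (n - 1 - (b + 2) - 1) (by omega)
          (by omega) (by omega), pr_inc_self, pr_inc_ne _ _ _ _ _ _ _ (by omega), map_zsmul,
          whisker_comp_zero s _ hsf]
        simp
      · rw [pr_d_apply (n - 1) n i j (i - 1) (j - 1) (by omega) (by omega) (by omega),
          pr_inc_ne _ _ _ _ _ _ _ (by omega), pr_inc_ne _ _ _ _ _ _ _ (by omega)]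
        simp
  rw [map_sub, h5]
  abel

lemma TE_of_flat (hF : IsAcyclic F) (M : ModuleCat.{0} A) [Module.Flat A M] : TE F M := by
  intro i j k hi hk x hx
  have hex := (exactAt_iff_elem F i j k hi hk).1 (hF j)
  have : Function.Exact (F.d i j).hom (F.d j k).hom := fun x =>
    ⟨fun h => hex x h, by rintro ⟨y, rfl⟩; exact d_d_apply F i j k y⟩
  exact (Module.Flat.lTensor_exact M this x).1 hx

/-- the inductive step of the resolution -/
def succ' {X₀ X₁ : ModuleCat.{0} A} (f : X₁ ⟶ X₀) :
    Σ' (X₂ : ModuleCat.{0} A) (d : X₂ ⟶ X₁), d ≫ f = 0 :=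
  ⟨Projective.syzygies f, Projective.d f, 
    (Category.assoc (Projective.π (kernel f)) (kernel.ι f) f).trans
      (by rw [kernel.condition, comp_zero]; rfl)⟩

/-- an augmented projective resolution -/
def res (M : ModuleCat.{0} A) : ChainComplex (ModuleCat.{0} A) ℕ :=
  ChainComplex.mk' M (Projective.over M) (Projective.π M) succ'

def resIso (M : ModuleCat.{0} A) (n : ℕ) :
    (res M).X (n + 2) ≅ Projective.syzygies ((res M).d (n + 1) n) :=
  ChainComplex.mk'XIso M (Projective.over M) (Projective.π M) succ' n

lemma res_d (M : ModuleCat.{0} A) (n : ℕ) :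
    (res M).d (n + 2) (n + 1) = (resIso M n).hom ≫ Projective.d ((res M).d (n + 1) n) :=
  ChainComplex.mk'_d M (Projective.over M) (Projective.π M) succ' n

lemma res_exact (M : ModuleCat.{0} A) (n : ℕ) : (res M).ExactAt n := by
  cases n with
  | zero =>
    rw [HomologicalComplex.exactAt_iff' _ 1 0 0 (by simp) (by simp)]
    have : Epi ((res M).sc' 1 0 0).f := by
      have h : ((res M).sc' 1 0 0).f = Projective.π M := ChainComplex.mk'_d_1_0 _ _ _ succ'
      rw [h]
      exact Projective.π_epi M
    rw [ShortComplex.moduleCat_exact_iff]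
    intro x _
    exact (ModuleCat.epi_iff_surjective _).1 this x
  | succ n =>
    rw [HomologicalComplex.exactAt_iff' _ (n + 1 + 1) (n + 1) n (by simp) (by simp)]
    have h := exact_d_f ((res M).d (n + 1) n)
    rw [ShortComplex.moduleCat_exact_iff] at h ⊢
    intro x hx
    obtain ⟨y, hy⟩ := h x hx
    refine ⟨(resIso M n).inv y, ?_⟩
    have h' : (resIso M n).inv ≫ (res M).d (n + 2) (n + 1) = Projective.d ((res M).d (n + 1) n) := by
      rw [res_d, Iso.inv_hom_id_assoc]
    exact (congrArg (fun g => g.hom y) h').trans hy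

lemma res_projective (M : ModuleCat.{0} A) (n : ℕ) : Projective ((res M).X (n + 1)) := by
  cases n with
  | zero => exact Projective.projective_over M
  | succ n =>
    exact Projective.of_iso (resIso M n).symm (Projective.projective_over _)

/-- the augmented resolution as a cochain complex -/
def resZ (M : ModuleCat.{0} A) : CochainComplex (ModuleCat.{0} A) ℤ :=
  (res M).extend ComplexShape.embeddingDownNat

lemma resZ_acyclic (M : ModuleCat.{0} A) : IsAcyclic (resZ M) := by
  intro i
  by_cases h : ∃ n : ℕ, ComplexShape.embeddingDownNat.f n = i
  · obtain ⟨n, hn⟩ := h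
    exact ((res M).extend_exactAt_iff ComplexShape.embeddingDownNat hn).2 (res_exact M n)
  · push Not at h
    exact (res M).extend_exactAt _ _ h

def resZIso (M : ModuleCat.{0} A) : (resZ M).X 0 ≅ M :=
  (res M).extendXIso ComplexShape.embeddingDownNat (i := 0) rfl

lemma resZ_zero (M : ModuleCat.{0} A) (i : ℤ) (hi : 0 < i) : IsZero ((resZ M).X i) :=
  (res M).isZero_extend_X _ _ (fun n hn => by
    have : -(n : ℤ) = i := hn
    omega)

lemma resZ_flat (M : ModuleCat.{0} A) (i : ℤ) (hi : i < 0) : Module.Flat A ((resZ M).X i) := by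
  obtain ⟨n, rfl⟩ : ∃ n : ℕ, i = -((n + 1 : ℕ) : ℤ) := ⟨(-i - 1).toNat, by omega⟩
  have h1 : Projective ((resZ M).X (-((n + 1 : ℕ) : ℤ))) :=
    Projective.of_iso ((res M).extendXIso ComplexShape.embeddingDownNat (i := n + 1) rfl).symm
      (res_projective M n)
  have := (IsProjective.iff_projective (R := A) ((resZ M).X (-((n + 1 : ℕ) : ℤ)))).2 h1
  infer_instance

lemma TE_of_iso {M N : ModuleCat.{0} A} (e : M ≅ N) (h : TE F M) : TE F N := by
  intro i j k hi hk x hx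
  obtain ⟨y, hy⟩ := h i j k hi hk ((e.inv ▷ F.X j) x) (by rw [whisker_exch, hx, map_zero])
  refine ⟨(e.hom ▷ F.X i) y, ?_⟩
  rw [whisker_exch, hy, whisker_comp, e.inv_hom_id, id_whiskerRight]
  rfl

lemma TE_zero (hF : IsAcyclic F) (hKF : IsKFlat F) (hG : IsAcyclic G)
    (hz : ∀ i : ℤ, 0 < i → IsZero (G.X i))
    (hfl : ∀ i : ℤ, i < 0 → Module.Flat A (G.X i)) : TE F (G.X 0) := by
  intro i j k hi hk x hx
  have hz' : ∀ (a c n : ℤ) (h : a + c = n) (y : (Tot G F).X n), 0 < a → pr G F a c n h y = 0 := by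
    intro a c n h y ha
    have h0 : 𝟙 (G.X a) = 0 := (hz a ha).eq_of_src _ _
    have h1 : 𝟙 (G.X a ⊗ F.X c) = 0 := by
      rw [← id_whiskerRight, h0, MonoidalPreadditive.zero_whiskerRight]
    exact congrArg (fun g => g.hom (pr G F a c n h y)) h1
  have hac := (exactAt_iff_elem _ i j k hi hk).1 (hKF G hG j)
  obtain ⟨y, hy⟩ := hac (inc G F 0 j j (by omega) x) (by
    apply tot_ext (G := G) (F := F)
    intro a c h
    rw [map_zero]
    rcases lt_trichotomy a 0 with ha | rfl | ha
    · exact pr_d_inc_lt _ _ _ _ _ hk _ _ _ _ ha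
    · obtain rfl : c = k := by omega
      exact (pr_d_inc_self _ _ _ _ _ _ hk hk x).trans (by rw [hx, smul_zero])
    · exact hz' _ _ _ _ _ ha)
  obtain ⟨u, -, hu⟩ := clear_le (G := G) (F := F) (-1)
    (fun a ha => by
      have := hfl a (by omega)
      exact TE_of_flat hF _) (i - 1) i j (by omega) hi y (fun a c h ha => by
        have h6 : (Tot G F).d i j y = inc G F 0 j j (by omega) x := hy
        rw [h6, pr_inc_ne _ _ _ _ _ _ _ (by omega)])
  obtain ⟨y', hy'⟩ : ∃ y', y' = y - (Tot G F).d (i - 1) i u := ⟨_, rfl⟩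
  have hd : (Tot G F).d i j y' = inc G F 0 j j (by omega) x := by
    rw [hy', map_sub, d_d_apply, sub_zero]
    exact hy
  have h7 := pr_d_apply i j 0 j (-1) i hi (by omega) hi (by omega) y'
  rw [hd, pr_inc_self, hy', hu (-1) _ _ le_rfl, ← hy', map_zero, zero_add] at h7
  refine ⟨pr G F 0 i i (by omega) y', ?_⟩
  rw [h7]
  simp

theorem main (F : CochainComplex (ModuleCat.{0} A) ℤ) (hF : IsAcyclic F) (hKF : IsKFlat F)
    (G : CochainComplex (ModuleCat.{0} A) ℤ) : IsAcyclic (HomologicalComplex.tensorObj G F) :=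
  tensor_of_TE F (fun M => TE_of_iso (resZIso M)
    (TE_zero hF hKF (resZ_acyclic M) (resZ_zero M) (resZ_flat M))) G

end

end KFlatAux

theorem tensor_acyclic_of_acyclic_of_kFlat
    (F : CochainComplex (ModuleCat A) ℤ) (hF : IsAcyclic F) (hKF : IsKFlat F) :
    ∀ G : CochainComplex (ModuleCat A) ℤ, IsAcyclic (HomologicalComplex.tensorObj G F) := by
  exact KFlatAux.main F hF hKF
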